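/- Under the protocol, if the graph sequence G(t) is B-core-connected for some positive integer B and D = sup_{i,j,t} D(i,j,t) is finite, then for every node i, x_i(t) converges as t → ∞ to the average of the initial values, lim_{t→∞} x_i(t) = (1/n) Σ_{j=1}^n x_j(0). -/

import Mathlib

open scoped Classical

noncomputable section

/-- The rounding function `R` sending `x` to `1`, `0`, `-1` according to `x > 1`,
`-1 ≤ x ≤ 1`, `x < -1`. -/
def Rq (y : ℝ) : ℝ := if y > 1 then 1 else if y < -1 then -1 else 0

/-- The data and evolution equations of the ternary-message average-consensus protocol
on `n` nodes.  `E t i j` means the edge `(i,j)` is present in the graph `G(t)`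
(for `t ≥ 1`); `x t i` is the value of node `i` at time `t`; `xin t i j` is
`x̂_{i,j,in}(t)`, `xout t i j` is `x̂_{i,j,out}(t)` and `q t i j` is `q_{i→j}(t)`. -/
structure Protocol (n : ℕ) where
  α : ℝ
  β : ℝ
  hα : 0 < α
  hαβ : α < β
  hβ : β < 1
  E : ℕ → Fin n → Fin n → Prop
  Esymm : ∀ t i j, E t i j → E t j i
  Eirrefl : ∀ t i, ¬ E t i i
  D : Fin n → Fin n → ℕ → ℝ
  Dsymm : ∀ i j t, D i j t = D j i t
  Dbound : ∀ t i j, E t i j →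
    ((max (Set.ncard {k | E t i k}) (Set.ncard {k | E t j k}) : ℕ) : ℝ) ≤ D i j t
  x : ℕ → Fin n → ℝ
  xin : ℕ → Fin n → Fin n → ℝ
  xout : ℕ → Fin n → Fin n → ℝ
  q : ℕ → Fin n → Fin n → ℝ
  hxin0 : ∀ i j, xin 0 i j = 0
  hxout0 : ∀ i j, xout 0 i j = 0
  hq : ∀ t, 1 ≤ t → ∀ i j, E t i j →
    q t i j = Rq ((t : ℝ) ^ α * (x (t - 1) i - xout (t - 1) i j))
  hxoutE : ∀ t, 1 ≤ t → ∀ i j, E t i j →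
    xout t i j = xout (t - 1) i j + q t i j / (t : ℝ) ^ α
  hxinE : ∀ t, 1 ≤ t → ∀ i j, E t i j →
    xin t i j = xin (t - 1) i j + q t j i / (t : ℝ) ^ α
  hxoutN : ∀ t, 1 ≤ t → ∀ i j, ¬ E t i j → xout t i j = xout (t - 1) i j
  hxinN : ∀ t, 1 ≤ t → ∀ i j, ¬ E t i j → xin t i j = xin (t - 1) i j
  hx : ∀ t, 1 ≤ t → ∀ i, x t i = x (t - 1) i + (1 / (t : ℝ) ^ β) *
    ∑ j ∈ Finset.univ.filter (fun j => E t i j ∧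
        4 / (t : ℝ) ^ α < |xin t i j - xout t i j| ∧ q t j i = 0 ∧ q t i j = 0),
      (xin t i j - xout t i j) / (4 * D i j t)

namespace Protocol

variable {n : ℕ} (P : Protocol n)

/-- The set `S(i,t)` of neighbors that node `i` includes in its update at time `t`. -/
def S (t : ℕ) (i : Fin n) : Finset (Fin n) :=
  Finset.univ.filter (fun j => P.E t i j ∧
    4 / (t : ℝ) ^ P.α < |P.xin t i j - P.xout t i j| ∧ P.q t j i = 0 ∧ P.q t i j = 0)

/-- The graph sequence of the protocol is `B`-core-connected with core edge
relation `Einf`: every core edge appears at some time, the graph of core edges is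
connected, and every core edge appears in every time window `[kB+1, (k+1)B]`. -/
def CoreConnected (B : ℕ) (Einf : Fin n → Fin n → Prop) : Prop :=
  (∀ i j, Einf i j → ∃ t, 1 ≤ t ∧ P.E t i j) ∧
  (SimpleGraph.fromRel Einf).Connected ∧
  ∀ k : ℕ, ∀ i j, Einf i j → ∃ t, k * B + 1 ≤ t ∧ t ≤ (k + 1) * B ∧ P.E t i j

end Protocol

/-- `M(x)`: the largest coordinate. -/
def maxV {n : ℕ} (y : Fin n → ℝ) : ℝ := ⨆ i, y i

/-- `m(x)`: the smallest coordinate. -/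
def minV {n : ℕ} (y : Fin n → ℝ) : ℝ := ⨅ i, y i

/-- `W(x) = M(x) - m(x)`. -/
def Wsp {n : ℕ} (y : Fin n → ℝ) : ℝ := maxV y - minV y

/-- The sup norm `‖x‖_∞ = max_i |x_i|`. -/
def normInf {n : ℕ} (y : Fin n → ℝ) : ℝ := ⨆ i, |y i|

/-- `V2(x) = sqrt(Σ_i (x_i - (1/n) Σ_j x_j)²)`. -/
def V2 {n : ℕ} (y : Fin n → ℝ) : ℝ :=
  Real.sqrt (∑ i, (y i - (∑ j, y j) / n) ^ 2)

lemma abs_le_one_of_Rq_eq_zero {y : ℝ} (h : Rq y = 0) : |y| ≤ 1 := by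
  unfold Rq at h
  split_ifs at h <;> first | (exfalso; linarith) | (rw [abs_le]; constructor <;> linarith)

lemma abs_sub_Rq_of_ne_zero {y : ℝ} (h : Rq y ≠ 0) : |y - Rq y| = |y| - 1 := by
  unfold Rq at h ⊢
  split_ifs at h ⊢ with h1 h2
  · rw [abs_of_pos (by linarith), abs_of_pos (by linarith)]
  · rw [abs_of_neg (by linarith), abs_of_neg (by linarith)]; ring
  · exact absurd rfl h

lemma tendsto_one_div_natCast_rpow {γ : ℝ} (hγ : 0 < γ) :
    Filter.Tendsto (fun m : ℕ => 1 / (m : ℝ) ^ γ) Filter.atTop (nhds 0) := by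
  refine ((tendsto_rpow_neg_atTop hγ).comp tendsto_natCast_atTop_atTop).congr (fun m => ?_)
  simp [Real.rpow_neg]

lemma le_add_mul_of_succ_le_add {f : ℕ → ℝ} {a : ℝ} {S T : ℕ}
    (h : ∀ t, S ≤ t → t < T → f (t + 1) ≤ f t + a) (hST : S ≤ T) :
    f T ≤ f S + (T - S : ℝ) * a := by
  induction T, hST using Nat.le_induction with
  | base => simp
  | succ T hST ih =>
    have h1 := ih (fun t h1 h2 => h t h1 (by omega))
    have h2 := h T hST (by omega)
    push_cast
    linarith

lemma le_add_mul_sub_of_succ_le_add {f : ℕ → ℝ} {a b : ℝ} {S T u : ℕ}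
    (h : ∀ t, S ≤ t → t < T → f (t + 1) ≤ f t + a) (hSu : S ≤ u) (huT : u < T)
    (hu : f (u + 1) ≤ f u + a - b) :
    f T ≤ f S + (T - S : ℝ) * a - b := by
  have h1 := le_add_mul_of_succ_le_add (fun t h1 h2 => h t h1 (by omega)) hSu
  have h2 := le_add_mul_of_succ_le_add (S := u + 1) (fun t h1 h2 => h t (by omega) h2) huT
  push_cast at h2
  linarith

lemma abs_sub_le_length_mul {V : Type*} {G : SimpleGraph V} {y : V → ℝ} {ε : ℝ}
    (h : ∀ u v, G.Adj u v → |y v - y u| ≤ ε) {u v : V} (p : G.Walk u v) :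
    |y v - y u| ≤ p.length * ε := by
  induction p with
  | nil => simp
  | cons hadj p ih =>
    rename_i a b c
    have h1 := h _ _ hadj
    have h2 := abs_sub_le (y c) (y b) (y a)
    simp only [SimpleGraph.Walk.length_cons]
    push_cast
    linarith

namespace Protocol

variable {n : ℕ} (P : Protocol n)

/-- The (unscaled) amount that node `i` receives from node `j` at time `t`. -/
def flow (t : ℕ) (i j : Fin n) : ℝ :=
  if j ∈ P.S t i then (P.xin t i j - P.xout t i j) / (4 * P.D i j t) else 0

/-- The step size `t^{-β}`. -/
def step (t : ℕ) : ℝ := 1 / (t : ℝ) ^ P.β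

/-- The error of the estimate of `x_i` that is attached to the pair `(i,j)`. -/
def err (t : ℕ) (i j : Fin n) : ℝ := P.x t i - P.xout t i j

/-- The squared deviation of the state at time `t` from the initial average. -/
def energy (t : ℕ) : ℝ := ∑ i, (P.x t i - (∑ j, P.x 0 j) / n) ^ 2

lemma β_pos : 0 < P.β := P.hα.trans P.hαβ

lemma step_pos (t : ℕ) : 0 < P.step (t + 1) := by
  unfold step; positivity

lemma step_le_one (t : ℕ) : P.step (t + 1) ≤ 1 := by
  unfold step
  rw [div_le_one (by positivity)]
  exact Real.one_le_rpow (by push_cast; linarith [Nat.cast_nonneg (α := ℝ) t]) P.β_pos.le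

lemma mem_S {t : ℕ} {i j : Fin n} : j ∈ P.S t i ↔ P.E t i j ∧
    4 / (t : ℝ) ^ P.α < |P.xin t i j - P.xout t i j| ∧ P.q t j i = 0 ∧ P.q t i j = 0 := by
  simp [S]

lemma xin_eq_xout (t : ℕ) (i j : Fin n) : P.xin t i j = P.xout t j i := by
  induction t with
  | zero => rw [P.hxin0, P.hxout0]
  | succ t ih =>
    by_cases h : P.E (t + 1) i j
    · rw [P.hxinE _ (by omega) _ _ h, P.hxoutE _ (by omega) _ _ (P.Esymm _ _ _ h)]
      simp [ih]
    · rw [P.hxinN _ (by omega) _ _ h,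
        P.hxoutN _ (by omega) _ _ (fun h' => h (P.Esymm _ _ _ h'))]
      simp [ih]

lemma mem_S_comm (t : ℕ) (i j : Fin n) : j ∈ P.S t i ↔ i ∈ P.S t j := by
  have key : ∀ i j : Fin n, j ∈ P.S t i → i ∈ P.S t j := by
    intro i j h
    rw [mem_S] at h ⊢
    refine ⟨P.Esymm _ _ _ h.1, ?_, h.2.2.2, h.2.2.1⟩
    have := h.2.1
    rw [xin_eq_xout] at this ⊢
    rwa [abs_sub_comm]
  exact ⟨key i j, key j i⟩

lemma flow_antisymm (t : ℕ) (i j : Fin n) : P.flow t j i = - P.flow t i j := by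
  unfold flow
  by_cases h : j ∈ P.S t i
  · rw [if_pos h, if_pos ((P.mem_S_comm t i j).1 h), P.Dsymm j i, P.xin_eq_xout, P.xin_eq_xout]
    ring
  · rw [if_neg h, if_neg (fun h' => h ((P.mem_S_comm t i j).2 h'))]
    simp

lemma x_succ (t : ℕ) (i : Fin n) :
    P.x (t + 1) i = P.x t i + P.step (t + 1) * ∑ j, P.flow (t + 1) i j := by
  rw [P.hx (t + 1) (by omega) i]
  simp only [Nat.add_sub_cancel, step, flow, ← Finset.sum_filter]
  congr 3
  ext j
  simp [S]

lemma sum_x (t : ℕ) : ∑ i, P.x t i = ∑ i, P.x 0 i := by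
  induction t with
  | zero => rfl
  | succ t ih =>
    simp only [x_succ, Finset.sum_add_distrib, ← Finset.mul_sum]
    have h : ∑ i, ∑ j, P.flow (t + 1) i j = - ∑ i, ∑ j, P.flow (t + 1) i j := by
      conv_lhs => rw [Finset.sum_comm]
      simp only [← Finset.sum_neg_distrib, ← P.flow_antisymm]
    rw [ih, show ∑ i, ∑ j, P.flow (t + 1) i j = 0 by linarith]
    simp

lemma one_le_D {t : ℕ} {i j : Fin n} (h : P.E t i j) : 1 ≤ P.D i j t := by
  refine le_trans ?_ (P.Dbound t i j h)
  have : 1 ≤ Set.ncard {k | P.E t i k} :=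
    (Set.ncard_pos (Set.toFinite _)).2 ⟨j, h⟩
  exact_mod_cast this.trans (le_max_left _ _)

lemma card_S_le_D {t : ℕ} {i j : Fin n} (h : P.E t i j) : ((P.S t i).card : ℝ) ≤ P.D i j t := by
  refine le_trans ?_ (P.Dbound t i j h)
  have : (P.S t i).card ≤ Set.ncard {k | P.E t i k} := by
    rw [← Set.ncard_coe_finset]
    refine Set.ncard_le_ncard (fun k hk => ?_) (Set.toFinite _)
    exact ((P.mem_S).1 (Finset.mem_coe.1 hk)).1
  exact_mod_cast this.trans (le_max_left _ _)

lemma xout_close {t : ℕ} {i j : Fin n} (h : P.E (t + 1) i j) (hq : P.q (t + 1) i j = 0) :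
    |P.x t i - P.xout (t + 1) i j| ≤ 1 / ((t + 1 : ℕ) : ℝ) ^ P.α := by
  have h1 := P.hq (t + 1) (by omega) i j h
  have h2 := P.hxoutE (t + 1) (by omega) i j h
  rw [hq] at h1 h2
  simp only [Nat.add_sub_cancel, zero_div, add_zero] at h1 h2
  have h3 := abs_le_one_of_Rq_eq_zero h1.symm
  have hr : 0 < ((t + 1 : ℕ) : ℝ) ^ P.α := by positivity
  rw [abs_mul, abs_of_pos hr] at h3
  rw [h2, le_div_iff₀ hr]
  linarith

lemma estimate_diff_close {t : ℕ} {i j : Fin n} (h : P.E (t + 1) i j)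
    (hij : P.q (t + 1) i j = 0) (hji : P.q (t + 1) j i = 0) :
    |(P.xin (t + 1) i j - P.xout (t + 1) i j) - (P.x t j - P.x t i)|
      ≤ 2 / ((t + 1 : ℕ) : ℝ) ^ P.α := by
  have h1 := abs_le.1 (P.xout_close h hij)
  have h2 := abs_le.1 (P.xout_close (P.Esymm _ _ _ h) hji)
  rw [P.xin_eq_xout]
  have h3 : 2 / ((t + 1 : ℕ) : ℝ) ^ P.α = 2 * (1 / ((t + 1 : ℕ) : ℝ) ^ P.α) := by ring
  rw [h3, abs_le]
  constructor <;> linarith [h1.1, h1.2, h2.1, h2.2]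

lemma flow_mul_diff_bounds {t : ℕ} {i j : Fin n} (h : j ∈ P.S (t + 1) i) :
    2 * P.D i j (t + 1) * P.flow (t + 1) i j ^ 2 ≤
        P.flow (t + 1) i j * (P.x t j - P.x t i) ∧
      (P.x t j - P.x t i) ^ 2 / (8 * P.D i j (t + 1)) ≤
        P.flow (t + 1) i j * (P.x t j - P.x t i) := by
  have hm := P.mem_S.1 h
  have hD := P.one_le_D hm.1
  have hc := P.estimate_diff_close hm.1 hm.2.2.2 hm.2.2.1
  have hδ := hm.2.1
  rw [flow, if_pos h]
  set δ := P.xin (t + 1) i j - P.xout (t + 1) i j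
  set d := P.x t j - P.x t i
  set D := P.D i j (t + 1)
  have h3 : |δ - d| ≤ |δ| / 2 := by
    have : 4 / ((t + 1 : ℕ) : ℝ) ^ P.α = 2 * (2 / ((t + 1 : ℕ) : ℝ) ^ P.α) := by ring
    linarith
  have h4 : (δ - d) ^ 2 ≤ δ ^ 2 / 4 := by
    rw [← sq_abs (δ - d), ← sq_abs δ]
    nlinarith [abs_nonneg (δ - d), abs_nonneg δ]
  have hD0 : 0 < D := by linarith
  constructor
  · rw [show 2 * D * (δ / (4 * D)) ^ 2 = (δ ^ 2 / 2) / (4 * D) by field_simp; ring,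
      div_mul_eq_mul_div]
    gcongr
    nlinarith [sq_nonneg (d - δ / 2)]
  · rw [show d ^ 2 / (8 * D) = (d ^ 2 / 2) / (4 * D) by field_simp; ring,
      div_mul_eq_mul_div]
    gcongr
    nlinarith [sq_nonneg δ]

lemma flow_mul_diff_nonneg (t : ℕ) (i j : Fin n) :
    0 ≤ P.flow (t + 1) i j * (P.x t j - P.x t i) := by
  by_cases h : j ∈ P.S (t + 1) i
  · have hD := P.one_le_D (P.mem_S.1 h).1
    exact le_trans (by positivity) (P.flow_mul_diff_bounds h).1
  · simp [flow, h]

lemma abs_flow_le (t : ℕ) (i j : Fin n) : |P.flow (t + 1) i j| ≤ |P.x t j - P.x t i| := by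
  by_cases h : j ∈ P.S (t + 1) i
  · have hD := P.one_le_D (P.mem_S.1 h).1
    have h1 := (P.flow_mul_diff_bounds h).1
    have h2 : |P.flow (t + 1) i j| ^ 2 ≤ |P.flow (t + 1) i j| * |P.x t j - P.x t i| := by
      rw [← abs_mul, sq_abs]
      refine le_trans ?_ (h1.trans (le_abs_self _))
      nlinarith [sq_nonneg (P.flow (t + 1) i j)]
    by_contra! hlt
    nlinarith [abs_nonneg (P.x t j - P.x t i)]
  · simp [flow, h]

lemma sq_sum_flow_le (t : ℕ) (i : Fin n) :
    (∑ j, P.flow (t + 1) i j) ^ 2 ≤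
      (1 / 2) * ∑ j, P.flow (t + 1) i j * (P.x t j - P.x t i) := by
  have hS : ∀ f : Fin n → ℝ, (∀ j, j ∉ P.S (t + 1) i → f j = 0) →
      ∑ j, f j = ∑ j ∈ P.S (t + 1) i, f j := fun f hf =>
    (Finset.sum_subset (Finset.subset_univ _) (fun j _ hj => hf j hj)).symm
  rw [hS _ (fun j hj => by simp [flow, hj]),
    hS (fun j => P.flow (t + 1) i j * (P.x t j - P.x t i)) (fun j hj => by simp [flow, hj])]
  refine (sq_sum_le_card_mul_sum_sq).trans ?_
  rw [Finset.mul_sum, Finset.mul_sum]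
  refine Finset.sum_le_sum (fun j hj => ?_)
  have h1 := (P.flow_mul_diff_bounds hj).1
  have h2 := P.card_S_le_D (P.mem_S.1 hj).1
  nlinarith [sq_nonneg (P.flow (t + 1) i j)]

lemma sum_mul_sum_flow (t : ℕ) (c : ℝ) :
    2 * ∑ i, (P.x t i - c) * ∑ j, P.flow (t + 1) i j =
      - ∑ i, ∑ j, P.flow (t + 1) i j * (P.x t j - P.x t i) := by
  have h1 : ∑ i, (P.x t i - c) * ∑ j, P.flow (t + 1) i j =
      ∑ i, ∑ j, P.flow (t + 1) i j * (P.x t i - c) := by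
    refine Finset.sum_congr rfl (fun i _ => ?_)
    rw [Finset.mul_sum]
    exact Finset.sum_congr rfl (fun j _ => mul_comm _ _)
  have h2 : ∑ i, ∑ j, P.flow (t + 1) i j * (P.x t i - c) =
      - ∑ i, ∑ j, P.flow (t + 1) i j * (P.x t j - c) := by
    rw [Finset.sum_comm]
    simp only [← Finset.sum_neg_distrib]
    refine Finset.sum_congr rfl (fun i _ => Finset.sum_congr rfl (fun j _ => ?_))
    rw [P.flow_antisymm (t + 1) i j]
    ring
  have h3 : ∑ i, ∑ j, P.flow (t + 1) i j * (P.x t j - P.x t i) =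
      ∑ i, ∑ j, P.flow (t + 1) i j * (P.x t j - c) -
        ∑ i, ∑ j, P.flow (t + 1) i j * (P.x t i - c) := by
    simp only [← Finset.sum_sub_distrib]
    refine Finset.sum_congr rfl (fun i _ => Finset.sum_congr rfl (fun j _ => ?_))
    ring
  rw [h1, h3]
  linarith

lemma energy_succ_le (t : ℕ) :
    P.energy (t + 1) ≤ P.energy t -
      P.step (t + 1) / 2 * ∑ i, ∑ j, P.flow (t + 1) i j * (P.x t j - P.x t i) := by
  unfold energy
  set c := (∑ j, P.x 0 j) / n
  set τ := P.step (t + 1)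
  have hτ0 : 0 < τ := P.step_pos t
  have hτ1 : τ ≤ 1 := P.step_le_one t
  have h1 : ∑ i, (P.x (t + 1) i - c) ^ 2 = ∑ i, (P.x t i - c) ^ 2 +
      τ * (2 * ∑ i, (P.x t i - c) * ∑ j, P.flow (t + 1) i j) +
      τ ^ 2 * ∑ i, (∑ j, P.flow (t + 1) i j) ^ 2 := by
    have h : ∀ i, (P.x (t + 1) i - c) ^ 2 = (P.x t i - c) ^ 2 +
        (2 * τ) * ((P.x t i - c) * ∑ j, P.flow (t + 1) i j) +
        τ ^ 2 * (∑ j, P.flow (t + 1) i j) ^ 2 := by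
      intro i
      rw [P.x_succ]
      ring
    simp only [h, Finset.sum_add_distrib, ← Finset.mul_sum]
    ring
  rw [h1, P.sum_mul_sum_flow]
  have h2 : ∑ i, (∑ j, P.flow (t + 1) i j) ^ 2 ≤
      (1 / 2) * ∑ i, ∑ j, P.flow (t + 1) i j * (P.x t j - P.x t i) := by
    rw [Finset.mul_sum]
    exact Finset.sum_le_sum (fun i _ => P.sq_sum_flow_le t i)
  set Q := ∑ i, ∑ j, P.flow (t + 1) i j * (P.x t j - P.x t i)
  have hQ : 0 ≤ Q :=
    Finset.sum_nonneg (fun i _ => Finset.sum_nonneg (fun j _ => P.flow_mul_diff_nonneg t i j))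
  have h3 : τ ^ 2 * ∑ i, (∑ j, P.flow (t + 1) i j) ^ 2 ≤ τ ^ 2 * ((1 / 2) * Q) := by gcongr
  have h4 : τ ^ 2 * Q ≤ τ * Q := by nlinarith [mul_nonneg hτ0.le hQ]
  linarith

lemma energy_succ_le_self (t : ℕ) : P.energy (t + 1) ≤ P.energy t := by
  have hQ : 0 ≤ ∑ i, ∑ j, P.flow (t + 1) i j * (P.x t j - P.x t i) :=
    Finset.sum_nonneg (fun i _ => Finset.sum_nonneg (fun j _ => P.flow_mul_diff_nonneg t i j))
  have := P.energy_succ_le t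
  have := mul_nonneg (P.step_pos t).le hQ
  linarith

lemma energy_antitone : Antitone P.energy := antitone_nat_of_succ_le P.energy_succ_le_self

lemma energy_nonneg (t : ℕ) : 0 ≤ P.energy t := Finset.sum_nonneg (fun _ _ => sq_nonneg _)

lemma energy_drop {t : ℕ} {i j : Fin n} (h : j ∈ P.S (t + 1) i) {Dsup : ℝ}
    (hD : P.D i j (t + 1) ≤ Dsup) :
    P.energy (t + 1) ≤ P.energy t -
      P.step (t + 1) * ((P.x t j - P.x t i) ^ 2 / (16 * Dsup)) := by
  have h1 := P.energy_succ_le t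
  have h2 := (P.flow_mul_diff_bounds h).2
  have hD1 := P.one_le_D (P.mem_S.1 h).1
  have h3 : P.flow (t + 1) i j * (P.x t j - P.x t i) ≤
      ∑ i, ∑ j, P.flow (t + 1) i j * (P.x t j - P.x t i) :=
    (Finset.single_le_sum (f := fun j => P.flow (t + 1) i j * (P.x t j - P.x t i))
      (fun j _ => P.flow_mul_diff_nonneg t i j) (Finset.mem_univ j)).trans
    (Finset.single_le_sum (f := fun i => ∑ j, P.flow (t + 1) i j * (P.x t j - P.x t i))
      (fun i _ => Finset.sum_nonneg (fun j _ => P.flow_mul_diff_nonneg t i j))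
      (Finset.mem_univ i))
  have h4 : (P.x t j - P.x t i) ^ 2 / (8 * Dsup) ≤
      (P.x t j - P.x t i) ^ 2 / (8 * P.D i j (t + 1)) := by gcongr
  have h5 := mul_le_mul_of_nonneg_left (h4.trans (h2.trans h3)) (P.step_pos t).le
  have h6 : P.step (t + 1) * ((P.x t j - P.x t i) ^ 2 / (16 * Dsup)) =
      P.step (t + 1) * ((P.x t j - P.x t i) ^ 2 / (8 * Dsup)) / 2 := by
    rw [show (16 : ℝ) * Dsup = 8 * Dsup * 2 by ring, ← div_div]; ring
  linarith

/-- A bound on the displacement of a node in one step, relative to the step size. -/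
def drift : ℝ := n * (2 * Real.sqrt (P.energy 0))

lemma drift_nonneg : 0 ≤ P.drift := by unfold drift; positivity

lemma abs_x_sub_average_le (t : ℕ) (i : Fin n) :
    |P.x t i - (∑ j, P.x 0 j) / n| ≤ Real.sqrt (P.energy 0) := by
  refine Real.abs_le_sqrt (le_trans ?_ (P.energy_antitone (Nat.zero_le t)))
  exact Finset.single_le_sum (f := fun i => (P.x t i - (∑ j, P.x 0 j) / n) ^ 2)
    (fun _ _ => sq_nonneg _) (Finset.mem_univ i)

lemma abs_x_succ_sub_le (t : ℕ) (i : Fin n) :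
    |P.x (t + 1) i - P.x t i| ≤ P.drift * P.step (t + 1) := by
  rw [P.x_succ, add_sub_cancel_left, abs_mul, abs_of_pos (P.step_pos t), mul_comm]
  refine mul_le_mul_of_nonneg_right ?_ (P.step_pos t).le
  refine (Finset.abs_sum_le_sum_abs _ _).trans ?_
  have : ∀ j ∈ Finset.univ, |P.flow (t + 1) i j| ≤ 2 * Real.sqrt (P.energy 0) := by
    intro j _
    refine (P.abs_flow_le t i j).trans ?_
    have h1 := abs_le.1 (P.abs_x_sub_average_le t i)
    have h2 := abs_le.1 (P.abs_x_sub_average_le t j)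
    rw [abs_le]
    constructor <;> linarith [h1.1, h1.2, h2.1, h2.2]
  refine (Finset.sum_le_card_nsmul _ _ _ this).trans ?_
  simp [drift]

lemma abs_err_succ_le (t : ℕ) (i j : Fin n) :
    |P.err (t + 1) i j| ≤ |P.err t i j| + P.drift * P.step (t + 1) -
      (if P.E (t + 1) i j ∧ P.q (t + 1) i j ≠ 0 then 1 / ((t + 1 : ℕ) : ℝ) ^ P.α else 0) := by
  have hd := P.abs_x_succ_sub_le t i
  have htri : |P.err (t + 1) i j| ≤
      |P.x (t + 1) i - P.x t i| + |P.x t i - P.xout (t + 1) i j| := by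
    unfold err
    exact abs_sub_le _ _ _
  suffices |P.x t i - P.xout (t + 1) i j| ≤ |P.err t i j| -
      (if P.E (t + 1) i j ∧ P.q (t + 1) i j ≠ 0 then 1 / ((t + 1 : ℕ) : ℝ) ^ P.α else 0) by
    linarith
  by_cases hE : P.E (t + 1) i j
  · have hout := P.hxoutE (t + 1) (by omega) i j hE
    have hq := P.hq (t + 1) (by omega) i j hE
    simp only [Nat.add_sub_cancel] at hout hq
    by_cases h0 : P.q (t + 1) i j = 0
    · simp [hout, h0, err]
    · rw [if_pos ⟨hE, h0⟩, hout]
      have hr : 0 < ((t + 1 : ℕ) : ℝ) ^ P.α := by positivity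
      have key := abs_sub_Rq_of_ne_zero (hq ▸ h0)
      rw [← hq, abs_mul, abs_of_pos hr] at key
      unfold err
      set r := ((t + 1 : ℕ) : ℝ) ^ P.α
      have e1 : P.x t i - (P.xout t i j + P.q (t + 1) i j / r) =
          (r * (P.x t i - P.xout t i j) - P.q (t + 1) i j) / r := by
        field_simp; ring
      rw [e1, abs_div, abs_of_pos hr, key]
      apply le_of_eq
      field_simp
  · have hout := P.hxoutN (t + 1) (by omega) i j hE
    simp only [Nat.add_sub_cancel] at hout
    simp [hout, hE, err]

/-- The total estimation error over all ordered pairs. -/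
def totalErr (t : ℕ) : ℝ := ∑ i, ∑ j, |P.err t i j|

lemma totalErr_nonneg (t : ℕ) : 0 ≤ P.totalErr t :=
  Finset.sum_nonneg (fun _ _ => Finset.sum_nonneg (fun _ _ => abs_nonneg _))

lemma totalErr_succ_le (t : ℕ) :
    P.totalErr (t + 1) ≤ P.totalErr t + n * (n * P.drift) * P.step (t + 1) -
      ∑ i, ∑ j, (if P.E (t + 1) i j ∧ P.q (t + 1) i j ≠ 0
        then 1 / ((t + 1 : ℕ) : ℝ) ^ P.α else 0) := by
  have h := Finset.sum_le_sum (fun i (_ : i ∈ (Finset.univ : Finset (Fin n))) =>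
    Finset.sum_le_sum (fun j (_ : j ∈ (Finset.univ : Finset (Fin n))) =>
      P.abs_err_succ_le t i j))
  simp only [Finset.sum_add_distrib, Finset.sum_sub_distrib, Finset.sum_const,
    Finset.card_univ, Fintype.card_fin, nsmul_eq_mul] at h
  unfold totalErr
  linarith

lemma totalErr_succ_le_add (t : ℕ) :
    P.totalErr (t + 1) ≤ P.totalErr t + n * (n * P.drift) * P.step (t + 1) := by
  refine (P.totalErr_succ_le t).trans (sub_le_self _ ?_)
  refine Finset.sum_nonneg (fun i _ => Finset.sum_nonneg (fun j _ => ?_))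
  split_ifs <;> positivity

lemma totalErr_drop {t : ℕ} {i j : Fin n} (hE : P.E (t + 1) i j) (hq : P.q (t + 1) i j ≠ 0) :
    P.totalErr (t + 1) ≤ P.totalErr t + n * (n * P.drift) * P.step (t + 1) -
      1 / ((t + 1 : ℕ) : ℝ) ^ P.α := by
  refine (P.totalErr_succ_le t).trans (sub_le_sub_left ?_ _)
  have hnn : ∀ i j, 0 ≤ (if P.E (t + 1) i j ∧ P.q (t + 1) i j ≠ 0
        then 1 / ((t + 1 : ℕ) : ℝ) ^ P.α else 0) := by
    intro i j
    split_ifs <;> positivity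
  have h1 := Finset.single_le_sum (fun j _ => hnn i j) (Finset.mem_univ j)
  have h2 := Finset.single_le_sum
    (fun i _ => Finset.sum_nonneg (s := (Finset.univ : Finset (Fin n))) (fun j _ => hnn i j))
    (Finset.mem_univ i)
  rw [if_pos ⟨hE, hq⟩] at h1
  exact h1.trans h2

lemma exists_adj_le_abs_sub (hn : 1 ≤ n) {G : SimpleGraph (Fin n)} (hG : G.Connected)
    {ε : ℝ} (hε : 0 < ε) :
    ∃ δ > 0, ∀ t, ε ≤ P.energy t → ∃ i j, G.Adj i j ∧ δ ≤ |P.x t j - P.x t i| := by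
  have hn0 : (0 : ℝ) < n := by exact_mod_cast hn
  refine ⟨Real.sqrt (ε / (2 * n ^ 3)), by positivity, fun t ht => ?_⟩
  set δ := Real.sqrt (ε / (2 * n ^ 3))
  have hδ0 : 0 < δ := by positivity
  have hδ2 : δ ^ 2 = ε / (2 * n ^ 3) := Real.sq_sqrt (by positivity)
  by_contra! hcon
  have hall : ∀ i j, |P.x t i - P.x t j| ≤ n * δ := by
    intro i j
    obtain ⟨p, hp⟩ := (hG.preconnected j i).exists_isPath
    refine (abs_sub_le_length_mul (fun u v huv => (hcon u v huv).le) p).trans ?_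
    have : (p.length : ℝ) ≤ n := by
      have := hp.length_lt
      rw [Fintype.card_fin] at this
      exact_mod_cast this.le
    gcongr
  have hdev : ∀ i, |P.x t i - (∑ j, P.x 0 j) / n| ≤ n * δ := by
    intro i
    have h1 : P.x t i - (∑ j, P.x 0 j) / n = (∑ j, (P.x t i - P.x t j)) / n := by
      rw [← P.sum_x t, Finset.sum_sub_distrib]
      simp
      field_simp
    rw [h1, abs_div, abs_of_pos hn0, div_le_iff₀ hn0]
    refine (Finset.abs_sum_le_sum_abs _ _).trans ?_
    refine (Finset.sum_le_card_nsmul _ _ _ (fun j _ => hall i j)).trans ?_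
    simp [mul_comm]
  have hbound : P.energy t ≤ n * (n * δ) ^ 2 := by
    unfold energy
    refine (Finset.sum_le_card_nsmul _ _ ((n * δ) ^ 2) (fun i _ => ?_)).trans (by simp)
    rw [← sq_abs]
    exact pow_le_pow_left₀ (abs_nonneg _) (hdev i) 2
  have : n * (n * δ) ^ 2 = ε / 2 := by
    rw [mul_pow, hδ2]; field_simp
  linarith

/-- The Lyapunov function: deviation energy plus weighted estimation error. -/
def potential (η : ℝ) (t : ℕ) : ℝ := P.energy t + η * P.totalErr t

lemma potential_nonneg {η : ℝ} (hη : 0 ≤ η) (t : ℕ) : 0 ≤ P.potential η t :=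
  add_nonneg (P.energy_nonneg t) (mul_nonneg hη (P.totalErr_nonneg t))

lemma potential_succ_le {η : ℝ} (hη : 0 ≤ η) (t : ℕ) :
    P.potential η (t + 1) ≤
      P.potential η t + η * (n * (n * P.drift)) * P.step (t + 1) := by
  have h1 := P.energy_succ_le_self t
  have h2 := mul_le_mul_of_nonneg_left (P.totalErr_succ_le_add t) hη
  unfold potential
  linarith

lemma potential_drop {η δ Dsup : ℝ} (hη : 0 ≤ η) (hδ : 0 ≤ δ) {t : ℕ} {i j : Fin n}
    (hE : P.E (t + 1) i j) (hD : P.D i j (t + 1) ≤ Dsup) (hdiff : δ ≤ |P.x t j - P.x t i|)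
    (hlarge : 6 * (1 / ((t + 1 : ℕ) : ℝ) ^ P.α) < δ)
    (hstep : δ ^ 2 / (16 * Dsup) * P.step (t + 1) ≤ η * (1 / ((t + 1 : ℕ) : ℝ) ^ P.α)) :
    P.potential η (t + 1) ≤ P.potential η t + η * (n * (n * P.drift)) * P.step (t + 1) -
      δ ^ 2 / (16 * Dsup) * P.step (t + 1) := by
  have hD1 := P.one_le_D hE
  unfold potential
  by_cases hij : P.q (t + 1) i j = 0
  · by_cases hji : P.q (t + 1) j i = 0
    · have hmem : j ∈ P.S (t + 1) i := by
        refine P.mem_S.2 ⟨hE, ?_, hji, hij⟩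
        have h1 := P.estimate_diff_close hE hij hji
        have h2 := abs_sub_abs_le_abs_sub (P.x t j - P.x t i)
          (P.xin (t + 1) i j - P.xout (t + 1) i j)
        rw [abs_sub_comm (P.x t j - P.x t i)] at h2
        have h3 : 2 / ((t + 1 : ℕ) : ℝ) ^ P.α = 2 * (1 / ((t + 1 : ℕ) : ℝ) ^ P.α) := by ring
        have h4 : 4 / ((t + 1 : ℕ) : ℝ) ^ P.α = 4 * (1 / ((t + 1 : ℕ) : ℝ) ^ P.α) := by ring
        rw [h4]
        rw [h3] at h1
        linarith
      have h1 := P.energy_drop hmem hD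
      have h2 := mul_le_mul_of_nonneg_left (P.totalErr_succ_le_add t) hη
      have h3 : δ ^ 2 / (16 * Dsup) ≤ (P.x t j - P.x t i) ^ 2 / (16 * Dsup) := by
        rw [← sq_abs (P.x t j - P.x t i)]
        have : 0 < Dsup := by linarith
        gcongr
      have h4 := mul_le_mul_of_nonneg_left h3 (P.step_pos t).le
      linarith
    · have h1 := P.energy_succ_le_self t
      have h2 := mul_le_mul_of_nonneg_left (P.totalErr_drop (P.Esymm _ _ _ hE) hji) hη
      linarith
  · have h1 := P.energy_succ_le_self t
    have h2 := mul_le_mul_of_nonneg_left (P.totalErr_drop hE hij) hη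
    linarith

lemma step_antitone {s t : ℕ} (hs : 1 ≤ s) (hst : s ≤ t) : P.step t ≤ P.step s := by
  unfold step
  have h0 : (0 : ℝ) < s := by exact_mod_cast hs
  exact one_div_le_one_div_of_le (by positivity)
    (Real.rpow_le_rpow h0.le (by exact_mod_cast hst) P.β_pos.le)

lemma step_le_two_mul {s t : ℕ} (hs : 1 ≤ s) (hst : t ≤ 2 * s) (ht : 1 ≤ t) :
    P.step s ≤ 2 * P.step t := by
  unfold step
  have h0 : (0 : ℝ) < s := by exact_mod_cast hs
  have h1 : (0 : ℝ) < t := by exact_mod_cast ht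
  have h2 : (t : ℝ) ^ P.β ≤ 2 * (s : ℝ) ^ P.β := by
    calc (t : ℝ) ^ P.β ≤ (2 * s : ℝ) ^ P.β :=
          Real.rpow_le_rpow h1.le (by exact_mod_cast hst) P.β_pos.le
      _ = 2 ^ P.β * (s : ℝ) ^ P.β := Real.mul_rpow (by norm_num) h0.le
      _ ≤ 2 ^ (1 : ℝ) * (s : ℝ) ^ P.β := by
          gcongr
          · norm_num
          · exact P.hβ.le
      _ = 2 * (s : ℝ) ^ P.β := by rw [Real.rpow_one]
  rw [mul_one_div, div_le_div_iff₀ (by positivity) (by positivity)]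
  linarith

lemma not_summable_step {B : ℕ} (hB : 0 < B) :
    ¬ Summable (fun k : ℕ => P.step ((k + 1) * B)) := by
  intro h
  have hB0 : (0 : ℝ) < B := by exact_mod_cast hB
  have h1 : Summable (fun k : ℕ => 1 / ((k + 1 : ℕ) : ℝ) ^ P.β) := by
    refine (h.mul_left ((B : ℝ) ^ P.β)).congr (fun k => ?_)
    unfold step
    push_cast
    rw [Real.mul_rpow (by positivity) hB0.le]
    field_simp
  rw [summable_nat_add_iff (f := fun k : ℕ => 1 / (k : ℝ) ^ P.β) 1,
    Real.summable_one_div_nat_rpow] at h1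
  linarith [P.hβ]

lemma eventually_mul_step_le (c : ℝ) {η : ℝ} (hη : 0 < η) :
    ∀ᶠ m : ℕ in Filter.atTop, c * P.step m ≤ η * (1 / (m : ℝ) ^ P.α) := by
  have h := (tendsto_one_div_natCast_rpow (sub_pos.2 P.hαβ)).const_mul c
  rw [mul_zero] at h
  filter_upwards [h.eventually_lt_const hη, Filter.eventually_ge_atTop 1] with m hm hm1
  have h0 : (0 : ℝ) < m := by exact_mod_cast hm1
  have h1 : P.step m = 1 / (m : ℝ) ^ (P.β - P.α) * (1 / (m : ℝ) ^ P.α) := by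
    unfold step
    rw [one_div_mul_one_div, ← Real.rpow_add h0, sub_add_cancel]
  rw [h1, ← mul_assoc]
  gcongr

lemma potential_window_drop {η δ Dsup : ℝ} (hη : 0 ≤ η) (hδ : 0 ≤ δ) {B k : ℕ}
    (hB : 0 < B) (hk : 1 ≤ k) {i j : Fin n}
    (hE : ∃ t, k * B + 1 ≤ t ∧ t ≤ (k + 1) * B ∧ P.E t i j)
    (hD : ∀ t i j, P.E t i j → P.D i j t ≤ Dsup)
    (hηsmall : 4 * B * (η * (n * (n * P.drift))) ≤ δ ^ 2 / (16 * Dsup))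
    (hdiff : 2 * δ ≤ |P.x (k * B) j - P.x (k * B) i|)
    (hdrift : 4 * B * P.drift * P.step ((k + 1) * B) ≤ δ)
    (hlarge : ∀ m : ℕ, k ≤ m → 6 * (1 / (m : ℝ) ^ P.α) < δ)
    (hstep : ∀ m : ℕ, k ≤ m →
      δ ^ 2 / (16 * Dsup) * P.step m ≤ η * (1 / (m : ℝ) ^ P.α)) :
    P.potential η ((k + 1) * B) ≤ P.potential η (k * B) -
      δ ^ 2 / (32 * Dsup) * P.step ((k + 1) * B) := by
  obtain ⟨t', ht1, ht2, htE⟩ := hE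
  obtain ⟨t, rfl⟩ : ∃ t, t' = t + 1 := ⟨t' - 1, by omega⟩
  have hkB : k ≤ k * B := Nat.le_mul_of_pos_right k hB
  have hBk : B ≤ k * B := Nat.le_mul_of_pos_left B hk
  have hN : (k + 1) * B = k * B + B := by ring
  have hNcast : (((k + 1) * B : ℕ) : ℝ) - ((k * B : ℕ) : ℝ) = B := by rw [hN]; push_cast; ring
  set s := P.step ((k + 1) * B)
  have hs : ∀ u, k * B ≤ u → u < (k + 1) * B → P.step (u + 1) ≤ 2 * s := fun u h1 h2 =>
    P.step_le_two_mul (by omega) (by omega) (by omega)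
  have hs0 : 0 ≤ s := by unfold s step; positivity
  have hC : 0 ≤ η * (n * (n * P.drift)) := by have := P.drift_nonneg; positivity
  have hmove : ∀ l, |P.x t l - P.x (k * B) l| ≤ B * (P.drift * (2 * s)) := by
    intro l
    have hone : ∀ u, k * B ≤ u → u < t →
        |P.x (u + 1) l - P.x u l| ≤ P.drift * (2 * s) := fun u h1 h2 =>
      (P.abs_x_succ_sub_le u l).trans
        (mul_le_mul_of_nonneg_left (hs u h1 (by omega)) P.drift_nonneg)
    have h1 := le_add_mul_of_succ_le_add (f := fun u => P.x u l) (S := k * B) (T := t)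
      (a := P.drift * (2 * s))
      (fun u h1 h2 => by linarith [(abs_le.1 (hone u h1 h2)).2]) (by omega)
    have h2 := le_add_mul_of_succ_le_add (f := fun u => - P.x u l) (S := k * B) (T := t)
      (a := P.drift * (2 * s))
      (fun u h1 h2 => by linarith [(abs_le.1 (hone u h1 h2)).1]) (by omega)
    have h3 : (t : ℝ) - ((k * B : ℕ) : ℝ) ≤ B := by
      rw [← hNcast]
      have : (t : ℝ) ≤ (((k + 1) * B : ℕ) : ℝ) := by exact_mod_cast (by omega : t ≤ (k + 1) * B)
      linarith
    have h4 := mul_le_mul_of_nonneg_right h3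
      (mul_nonneg P.drift_nonneg (by linarith : 0 ≤ 2 * s))
    rw [abs_le]
    constructor <;> linarith
  have hdiff' : δ ≤ |P.x t j - P.x t i| := by
    have h1 := hmove i
    have h2 := hmove j
    have h3 : |P.x (k * B) j - P.x (k * B) i| ≤
        |P.x t j - P.x t i| + |P.x t j - P.x (k * B) j| + |P.x t i - P.x (k * B) i| := by
      rw [show P.x (k * B) j - P.x (k * B) i = (P.x t j - P.x t i) -
        (P.x t j - P.x (k * B) j) + (P.x t i - P.x (k * B) i) by ring]
      exact (abs_add_le _ _).trans (by gcongr; exact abs_sub _ _)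
    linarith
  have hdrop := P.potential_drop hη hδ htE (hD _ _ _ htE) hdiff' (hlarge _ (by omega))
    (hstep _ (by omega))
  have hD1 : 1 ≤ Dsup := (P.one_le_D htE).trans (hD _ _ _ htE)
  have hc : 0 ≤ δ ^ 2 / (16 * Dsup) := by positivity
  have hst : s ≤ P.step (t + 1) := P.step_antitone (by omega) ht2
  have hfin := le_add_mul_sub_of_succ_le_add (f := P.potential η)
    (a := η * (n * (n * P.drift)) * (2 * s)) (b := δ ^ 2 / (16 * Dsup) * s)
    (S := k * B) (T := (k + 1) * B) (u := t)
    (fun u h1 h2 => (P.potential_succ_le hη u).trans (by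
      have := mul_le_mul_of_nonneg_left (hs u h1 h2) hC
      linarith)) (by omega) (by omega) (by
      have h1 := mul_le_mul_of_nonneg_left (hs t (by omega) (by omega)) hC
      have h2 := mul_le_mul_of_nonneg_left hst hc
      linarith)
  rw [hNcast] at hfin
  have h5 := mul_le_mul_of_nonneg_right hηsmall hs0
  have h6 : δ ^ 2 / (32 * Dsup) = δ ^ 2 / (16 * Dsup) / 2 := by
    rw [show (32 : ℝ) * Dsup = 16 * Dsup * 2 by ring, ← div_div]
  rw [h6]
  linarith

lemma exists_energy_lt (hn : 1 ≤ n) {B : ℕ} (hB : 0 < B) {Einf : Fin n → Fin n → Prop}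
    (hcore : P.CoreConnected B Einf) {Dsup : ℝ} (hD : ∀ t i j, P.E t i j → P.D i j t ≤ Dsup)
    {ε : ℝ} (hε : 0 < ε) : ∃ t, P.energy t < ε := by
  by_contra! hcon
  obtain ⟨δ', hδ', hadj⟩ := P.exists_adj_le_abs_sub hn hcore.2.1 hε
  obtain ⟨δ, hδ, rfl⟩ : ∃ δ > 0, δ' = 2 * δ := ⟨δ' / 2, by positivity, by ring⟩
  have hwin : ∀ k t, ∃ i j, (∃ u, k * B + 1 ≤ u ∧ u ≤ (k + 1) * B ∧ P.E u i j) ∧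
      2 * δ ≤ |P.x t j - P.x t i| := by
    intro k t
    obtain ⟨i, j, hij, hd⟩ := hadj t (hcon t)
    refine ⟨i, j, ?_, hd⟩
    rcases ((SimpleGraph.fromRel_adj _ _ _).1 hij).2 with h | h
    · exact hcore.2.2 k i j h
    · obtain ⟨u, h1, h2, h3⟩ := hcore.2.2 k j i h
      exact ⟨u, h1, h2, P.Esymm _ _ _ h3⟩
  have hD1 : 1 ≤ Dsup := by
    obtain ⟨i, j, ⟨u, -, -, hu⟩, -⟩ := hwin 0 0
    exact (P.one_le_D hu).trans (hD _ _ _ hu)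
  set C := n * (n * P.drift) with hCdef
  have hC : 0 ≤ C := by have := P.drift_nonneg; positivity
  set c := δ ^ 2 / (16 * Dsup) with hcdef
  have hc : 0 < c := by positivity
  set η := c / (4 * B * C + 1)
  have hη : 0 < η := by positivity
  have hηsmall : 4 * B * (η * C) ≤ c := by
    have h1 : η * (4 * B * C + 1) = c := div_mul_cancel₀ _ (by positivity)
    linarith
  have hev1 : ∀ᶠ m : ℕ in Filter.atTop, 6 * (1 / (m : ℝ) ^ P.α) < δ := by
    have h := (tendsto_one_div_natCast_rpow P.hα).const_mul 6
    rw [mul_zero] at h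
    exact h.eventually_lt_const hδ
  have hev2 := P.eventually_mul_step_le c hη
  have hev3 : ∀ᶠ m : ℕ in Filter.atTop, 4 * B * P.drift * P.step m < δ := by
    have h := (tendsto_one_div_natCast_rpow P.β_pos).const_mul (4 * B * P.drift)
    rw [mul_zero] at h
    exact h.eventually_lt_const hδ
  obtain ⟨M, hM⟩ := Filter.eventually_atTop.1 (hev1.and (hev2.and hev3))
  have hdrop : ∀ k, P.potential η ((k + (M + 1) + 1) * B) ≤
      P.potential η ((k + (M + 1)) * B) -
        δ ^ 2 / (32 * Dsup) * P.step ((k + (M + 1) + 1) * B) := by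
    intro k
    obtain ⟨i, j, hE, hd⟩ := hwin (k + (M + 1)) ((k + (M + 1)) * B)
    refine P.potential_window_drop hη.le hδ.le hB (by omega) hE hD hηsmall hd ?_
      (fun m hm => (hM m (by omega)).1) (fun m hm => (hM m (by omega)).2.1)
    refine (hM _ ?_).2.2.le
    have := Nat.le_mul_of_pos_right (k + (M + 1) + 1) hB
    omega
  have hsum : ∀ K, ∑ k ∈ Finset.range K,
      δ ^ 2 / (32 * Dsup) * P.step ((k + (M + 1) + 1) * B) ≤
        P.potential η ((0 + (M + 1)) * B) - P.potential η ((K + (M + 1)) * B) := by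
    intro K
    induction K with
    | zero => simp
    | succ K ih =>
      rw [Finset.sum_range_succ]
      have := hdrop K
      rw [show K + 1 + (M + 1) = K + (M + 1) + 1 by ring]
      linarith
  have hsummable : Summable
      (fun k : ℕ => δ ^ 2 / (32 * Dsup) * P.step ((k + (M + 1) + 1) * B)) :=
    summable_of_sum_range_le (c := P.potential η ((0 + (M + 1)) * B))
      (fun k => by unfold step; positivity)
      (fun K => (hsum K).trans (sub_le_self _ (P.potential_nonneg hη.le _)))
  have h32 : δ ^ 2 / (32 * Dsup) ≠ 0 := by positivity
  rw [summable_mul_left_iff h32,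
    summable_nat_add_iff (f := fun k : ℕ => P.step ((k + 1) * B)) (M + 1)] at hsummable
  exact P.not_summable_step hB hsummable

end Protocol

/-- under the protocol, on a `B`-core-connected graph sequence with
`sup D(i,j,t)` finite, every `x_i(t)` converges to the average of the initial values. -/
theorem stmt0_consensus_convergence {n : ℕ} (hn : 1 ≤ n) (P : Protocol n)
    (B : ℕ) (hB : 0 < B) (Einf : Fin n → Fin n → Prop)
    (hcore : P.CoreConnected B Einf)
    (Dsup : ℝ) (hDsup : ∀ t i j, P.E t i j → P.D i j t ≤ Dsup)
    (i : Fin n) :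
    Filter.Tendsto (fun t => P.x t i) Filter.atTop (nhds ((∑ j, P.x 0 j) / n)) := by
  rw [Metric.tendsto_atTop]
  intro ε hε
  obtain ⟨T, hT⟩ := P.exists_energy_lt hn hB hcore hDsup (sq_pos_of_pos hε)
  refine ⟨T, fun t ht => ?_⟩
  rw [Real.dist_eq]
  refine abs_lt_of_sq_lt_sq ?_ hε.le
  refine lt_of_le_of_lt ?_ ((P.energy_antitone ht).trans_lt hT)
  exact Finset.single_le_sum (f := fun i => (P.x t i - (∑ j, P.x 0 j) / n) ^ 2)
    (fun _ _ => sq_nonneg _) (Finset.mem_univ i)
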